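/- arXiv:2404.04994 — 4 statements merged into one kernel-verified Lean document; each statement's English description precedes it below -/
import Mathlib

section
/- Let n ≥ 1 and m ≥ 1. Let c be a symmetric (n+m)×(n+m) real matrix with all entries nonnegative, and define the Maxwell capacitance matrix C^M by C^M_{ij} = (∑_k c_{ik}) if i = j and C^M_{ij} = −c_{ij} if i ≠ j. Let C be the upper-left n×n block of C^M. If for every index i ≤ n there exists an index j > n with c_{ij} > 0, then C is positive definite. -/
open Matrix Finset

/-- A real symmetric matrix that is strictly diagonally dominant with positive diagonal is
positive definite. -/
theorem Matrix.IsHermitian.posDef_of_sum_norm_lt_diag {ι : Type*} [Fintype ι] [DecidableEq ι]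
    {A : Matrix ι ι ℝ} (hA : A.IsHermitian)
    (h : ∀ i, ∑ j ∈ Finset.univ.erase i, ‖A i j‖ < A i i) : A.PosDef := by
  rw [hA.posDef_iff_eigenvalues_pos]
  intro k
  have hμ : Module.End.HasEigenvalue (Matrix.toLin' A) (hA.eigenvalues k) := by
    rw [Module.End.hasEigenvalue_iff_mem_spectrum, Matrix.spectrum_toLin']
    exact hA.eigenvalues_mem_spectrum_real k
  obtain ⟨i, hi⟩ := eigenvalue_mem_ball hμ
  rw [Metric.mem_closedBall, Real.dist_eq] at hi
  linarith [h i, (abs_le.mp hi).1]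

/-- The dot-dot block `C` of the Maxwell capacitance matrix `CM` of a nonnegative
symmetric capacitance network, in which every dot is coupled to at least one gate,
is positive definite. -/
theorem stmt_0 (n m : ℕ) (hn : 1 ≤ n) (hm : 1 ≤ m)
    (c : Matrix (Fin (n + m)) (Fin (n + m)) ℝ)
    (hsymm : ∀ i j, c i j = c j i)
    (hnonneg : ∀ i j, 0 ≤ c i j)
    (CM : Matrix (Fin (n + m)) (Fin (n + m)) ℝ)
    (hCM : ∀ i j, CM i j = if i = j then ∑ k, c i k else -c i j)
    (C : Matrix (Fin n) (Fin n) ℝ)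
    (hC : ∀ i j, C i j = CM (Fin.castAdd m i) (Fin.castAdd m j))
    (hcoupled : ∀ i : Fin n, ∃ j : Fin m, 0 < c (Fin.castAdd m i) (Fin.natAdd n j)) :
    C.PosDef := by
  have hC_offDiag : ∀ i j, j ≠ i → C i j = -c (Fin.castAdd m i) (Fin.castAdd m j) := by
    intro i j hij
    rw [hC, hCM, if_neg]
    exact fun h => hij (Fin.castAdd_injective n m h).symm
  apply Matrix.IsHermitian.posDef_of_sum_norm_lt_diag
  · refine Matrix.IsHermitian.ext fun i j => ?_
    rw [star_trivial]
    obtain rfl | hij := eq_or_ne i j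
    · rfl
    · rw [hC_offDiag j i hij, hC_offDiag i j hij.symm, hsymm]
  · intro i
    have hgate : 0 < ∑ j, c (Fin.castAdd m i) (Fin.natAdd n j) := by
      obtain ⟨j, hj⟩ := hcoupled i
      exact Finset.sum_pos' (fun _ _ => hnonneg _ _) ⟨j, Finset.mem_univ j, hj⟩
    calc ∑ j ∈ Finset.univ.erase i, ‖C i j‖
        = ∑ j ∈ Finset.univ.erase i, c (Fin.castAdd m i) (Fin.castAdd m j) := by
          refine Finset.sum_congr rfl fun j hj => ?_
          rw [hC_offDiag i j (Finset.ne_of_mem_erase hj), norm_neg,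
            Real.norm_of_nonneg (hnonneg _ _)]
      _ ≤ ∑ j, c (Fin.castAdd m i) (Fin.castAdd m j) :=
          Finset.sum_le_sum_of_subset_of_nonneg (Finset.erase_subset _ _)
            fun _ _ _ => hnonneg _ _
      _ < ∑ k, c (Fin.castAdd m i) k := by
          rw [Fin.sum_univ_add]
          exact lt_add_of_pos_right _ hgate
      _ = C i i := by rw [hC, hCM, if_pos rfl]
end

section
/- Let M be an n×n real symmetric positive definite matrix with smallest eigenvalue λ_min and largest eigenvalue λ_max, and suppose the condition number satisfies λ_max/λ_min ≤ 1 + 4/n. Let b ∈ ℝⁿ, let f(x) = ½ xᵀ M x + bᵀ x, and let x* = −M⁻¹ b be the unconstrained minimizer of f over ℝⁿ. Then there exists w ∈ ℤⁿ with w_i ∈ {⌊x*_i⌋, ⌈x*_i⌉} for every i such that f(w) ≤ f(z) for all z ∈ ℤⁿ; that is, one of the 2ⁿ surrounding integer neighbours of the continuous minimizer is a global minimizer of f over ℤⁿ. -/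
open Matrix

/-- The quadratic form of a Hermitian real matrix, diagonalised by its eigenvector matrix. -/
theorem Matrix.IsHermitian.exists_dotProduct_mulVec_eq_sum {n : ℕ}
    {M : Matrix (Fin n) (Fin n) ℝ} (hM : M.IsHermitian) (v : Fin n → ℝ) :
    ∃ y : Fin n → ℝ, v ⬝ᵥ v = ∑ i, y i ^ 2 ∧
      v ⬝ᵥ (M *ᵥ v) = ∑ i, hM.eigenvalues i * y i ^ 2 := by
  set U : Matrix (Fin n) (Fin n) ℝ := (hM.eigenvectorUnitary : Matrix (Fin n) (Fin n) ℝ) with hU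
  have hUU : U * Uᵀ = 1 := by
    have h := Unitary.mul_star_self_of_mem hM.eigenvectorUnitary.2
    rwa [star_eq_conjTranspose, conjTranspose_eq_transpose_of_trivial] at h
  have hspec : M = U * diagonal hM.eigenvalues * Uᵀ := by
    have h := hM.spectral_theorem
    rw [Unitary.conjStarAlgAut_apply, star_eq_conjTranspose,
      conjTranspose_eq_transpose_of_trivial] at h
    exact h
  refine ⟨Uᵀ *ᵥ v, ?_, ?_⟩
  · have h : (Uᵀ *ᵥ v) ⬝ᵥ (Uᵀ *ᵥ v) = v ⬝ᵥ v := by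
      rw [dotProduct_mulVec, vecMul_transpose, mulVec_mulVec, hUU, one_mulVec]
    rw [← h]
    simp only [dotProduct, sq]
  · have h : v ⬝ᵥ ((U * diagonal hM.eigenvalues * Uᵀ) *ᵥ v) =
        (Uᵀ *ᵥ v) ⬝ᵥ (diagonal hM.eigenvalues *ᵥ (Uᵀ *ᵥ v)) := by
      rw [← mulVec_mulVec, ← mulVec_mulVec, dotProduct_mulVec, mulVec_transpose]
    rw [← hspec] at h
    rw [h]
    simp only [dotProduct, mulVec_diagonal]
    exact Finset.sum_congr rfl fun i _ => by ring

theorem Matrix.IsHermitian.mul_dotProduct_self_le {n : ℕ}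
    {M : Matrix (Fin n) (Fin n) ℝ} (hM : M.IsHermitian) {c : ℝ}
    (hc : ∀ i, c ≤ hM.eigenvalues i) (v : Fin n → ℝ) :
    c * (v ⬝ᵥ v) ≤ v ⬝ᵥ (M *ᵥ v) := by
  obtain ⟨y, hy, hMy⟩ := hM.exists_dotProduct_mulVec_eq_sum v
  rw [hy, hMy, Finset.mul_sum]
  exact Finset.sum_le_sum fun i _ => mul_le_mul_of_nonneg_right (hc i) (sq_nonneg _)

theorem Matrix.IsHermitian.dotProduct_mulVec_le_mul {n : ℕ}
    {M : Matrix (Fin n) (Fin n) ℝ} (hM : M.IsHermitian) {c : ℝ}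
    (hc : ∀ i, hM.eigenvalues i ≤ c) (v : Fin n → ℝ) :
    v ⬝ᵥ (M *ᵥ v) ≤ c * (v ⬝ᵥ v) := by
  obtain ⟨y, hy, hMy⟩ := hM.exists_dotProduct_mulVec_eq_sum v
  rw [hy, hMy, Finset.mul_sum]
  exact Finset.sum_le_sum fun i _ => mul_le_mul_of_nonneg_right (hc i) (sq_nonneg _)

theorem round_eq_floor_or_ceil (x : ℝ) : round x = ⌊x⌋ ∨ round x = ⌈x⌉ := by
  rw [round]
  split_ifs <;> simp

/-- An integer other than the two neighbours of `x` is farther from `x` than `round x`, by at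
least one in squared distance. -/
theorem sq_round_sub_add_one_le {x : ℝ} {z : ℤ} (hz : ¬(z = ⌊x⌋ ∨ z = ⌈x⌉)) :
    ((round x : ℝ) - x) ^ 2 + 1 ≤ ((z : ℝ) - x) ^ 2 := by
  push Not at hz
  have hfc := Int.floor_le_ceil x
  have hcf := Int.ceil_le_floor_add_one x
  have hz' : z + 1 ≤ ⌊x⌋ ∨ ⌈x⌉ + 1 ≤ z := by omega
  have habs : |(round x : ℝ) - x| + 1 ≤ |(z : ℝ) - x| := by
    rcases hz' with h | h
    · have hle := round_le x ⌊x⌋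
      have hfl := Int.floor_le x
      have h' : (z : ℝ) + 1 ≤ ⌊x⌋ := by exact_mod_cast h
      rw [abs_sub_comm x, abs_sub_comm x, abs_of_nonpos (by linarith : (⌊x⌋ : ℝ) - x ≤ 0)] at hle
      rw [abs_of_nonpos (by linarith : (z : ℝ) - x ≤ 0)]
      linarith
    · have hle := round_le x ⌈x⌉
      have hcl := Int.le_ceil x
      have h' : (⌈x⌉ : ℝ) + 1 ≤ z := by exact_mod_cast h
      rw [abs_sub_comm x, abs_sub_comm x, abs_of_nonneg (by linarith : 0 ≤ (⌈x⌉ : ℝ) - x)] at hle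
      rw [abs_of_nonneg (by linarith : 0 ≤ (z : ℝ) - x)]
      linarith
  rw [← sq_abs ((round x : ℝ) - x), ← sq_abs ((z : ℝ) - x)]
  nlinarith [abs_nonneg ((round x : ℝ) - x)]

theorem sq_round_sub_le (x : ℝ) (z : ℤ) : ((round x : ℝ) - x) ^ 2 ≤ ((z : ℝ) - x) ^ 2 := by
  rw [sq_le_sq, abs_sub_comm, abs_sub_comm (z : ℝ)]
  exact round_le x z

/-- Completing the square in a quadratic function with critical point `c`. -/
theorem Matrix.IsHermitian.quadratic_eq {n : ℕ} {M : Matrix (Fin n) (Fin n) ℝ}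
    (hM : M.IsHermitian) {b c : Fin n → ℝ} (hc : M *ᵥ c = -b) (x : Fin n → ℝ) :
    (1 / 2) * (x ⬝ᵥ (M *ᵥ x)) + b ⬝ᵥ x =
      (1 / 2) * ((x - c) ⬝ᵥ (M *ᵥ (x - c))) - (1 / 2) * (c ⬝ᵥ (M *ᵥ c)) := by
  have hsymm : c ⬝ᵥ (M *ᵥ x) = -(b ⬝ᵥ x) := by
    rw [dotProduct_mulVec, ← mulVec_transpose, ← conjTranspose_eq_transpose_of_trivial, hM.eq,
      hc, neg_dotProduct]
  have hxb : x ⬝ᵥ (M *ᵥ c) = -(b ⬝ᵥ x) := by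
    rw [hc, dotProduct_neg, dotProduct_comm]
  rw [mulVec_sub, dotProduct_sub, sub_dotProduct, sub_dotProduct, hsymm, hxb]
  ring

/-- If the condition number `λ_max/λ_min` of the symmetric positive definite matrix `M`
is at most `1 + 4/n`, then one of the `2ⁿ` surrounding integer neighbours of the
continuous minimiser `x* = −M⁻¹b` of `f(x) = ½ xᵀ M x + bᵀ x` is a global minimiser
of `f` over `ℤⁿ`. -/
theorem stmt_7 (n : ℕ)
    (M : Matrix (Fin n) (Fin n) ℝ) (hM : M.PosDef)
    (lmin lmax : ℝ)
    (hmin_mem : ∃ i, hM.1.eigenvalues i = lmin)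
    (hmin_le : ∀ i, lmin ≤ hM.1.eigenvalues i)
    (hmax_mem : ∃ i, hM.1.eigenvalues i = lmax)
    (hmax_ge : ∀ i, hM.1.eigenvalues i ≤ lmax)
    (hcond : lmax / lmin ≤ 1 + 4 / (n : ℝ))
    (b : Fin n → ℝ)
    (f : (Fin n → ℝ) → ℝ)
    (hf : ∀ x, f x = (1 / 2) * (x ⬝ᵥ (M *ᵥ x)) + b ⬝ᵥ x)
    (xstar : Fin n → ℝ) (hxstar : xstar = -(M⁻¹ *ᵥ b)) :
    ∃ w : Fin n → ℤ, (∀ i, w i = ⌊xstar i⌋ ∨ w i = ⌈xstar i⌉) ∧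
      ∀ z : Fin n → ℤ, f (fun i => (w i : ℝ)) ≤ f (fun i => (z i : ℝ)) := by
  obtain ⟨i₀, hi₀⟩ := hmin_mem
  have hlmin : 0 < lmin := hi₀ ▸ hM.eigenvalues_pos i₀
  have hn : (0 : ℝ) < n := Nat.cast_pos.mpr i₀.pos
  have hcrit : M *ᵥ xstar = -b := by
    rw [hxstar, mulVec_neg, mulVec_mulVec,
      mul_nonsing_inv _ ((isUnit_iff_isUnit_det M).mp hM.isUnit), one_mulVec]
  have hround : ∀ z : Fin n → ℤ, ¬(∀ i, z i = ⌊xstar i⌋ ∨ z i = ⌈xstar i⌉) →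
      f (fun i => (round (xstar i) : ℝ)) ≤ f (fun i => (z i : ℝ)) := by
    intro z hz
    obtain ⟨j, hj⟩ := not_forall.mp hz
    rw [hf, hf, hM.1.quadratic_eq hcrit, hM.1.quadratic_eq hcrit]
    set u : Fin n → ℝ := (fun i => (round (xstar i) : ℝ)) - xstar with hu
    set v : Fin n → ℝ := (fun i => (z i : ℝ)) - xstar with hv
    have hupper := hM.1.dotProduct_mulVec_le_mul hmax_ge u
    have hlower := hM.1.mul_dotProduct_self_le hmin_le v
    have hgap : u ⬝ᵥ u + 1 ≤ v ⬝ᵥ v := by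
      have hsum : ∑ i, (u i * u i + if i = j then 1 else 0) ≤ ∑ i, v i * v i := by
        refine Finset.sum_le_sum fun i _ => ?_
        simp only [hu, hv, Pi.sub_apply, ← sq]
        split_ifs with hij
        · exact hij ▸ sq_round_sub_add_one_le hj
        · simpa using sq_round_sub_le (xstar i) (z i)
      simpa [Finset.sum_add_distrib, dotProduct] using hsum
    have husmall : u ⬝ᵥ u ≤ n / 4 := by
      have hsum : ∑ i, u i * u i ≤ ∑ _i : Fin n, (1 / 4 : ℝ) := by
        refine Finset.sum_le_sum fun i _ => ?_
        have h := abs_le.mp (abs_sub_round (xstar i))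
        simp only [hu, Pi.sub_apply]
        nlinarith [h.1, h.2]
      simpa [dotProduct, div_eq_mul_inv] using hsum
    have hunonneg : 0 ≤ u ⬝ᵥ u := Finset.sum_nonneg fun i _ => mul_self_nonneg (u i)
    have hlmax : lmax ≤ (1 + 4 / (n : ℝ)) * lmin := (div_le_iff₀ hlmin).mp hcond
    have hratio : 4 / (n : ℝ) * (u ⬝ᵥ u) ≤ 1 := by
      rw [div_mul_eq_mul_div, div_le_one hn]
      linarith
    have hchain : lmax * (u ⬝ᵥ u) ≤ lmin * (v ⬝ᵥ v) := calc
      lmax * (u ⬝ᵥ u) ≤ (1 + 4 / (n : ℝ)) * lmin * (u ⬝ᵥ u) :=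
        mul_le_mul_of_nonneg_right hlmax hunonneg
      _ = lmin * (u ⬝ᵥ u + 4 / (n : ℝ) * (u ⬝ᵥ u)) := by ring
      _ ≤ lmin * (v ⬝ᵥ v) := mul_le_mul_of_nonneg_left (by linarith) hlmin.le
    linarith
  let N : Finset (Fin n → ℤ) := Fintype.piFinset fun i => {⌊xstar i⌋, ⌈xstar i⌉}
  have hN : ∀ z, z ∈ N ↔ ∀ i, z i = ⌊xstar i⌋ ∨ z i = ⌈xstar i⌉ := by simp [N]
  have hroundN : (fun i => round (xstar i)) ∈ N :=
    (hN _).mpr fun i => round_eq_floor_or_ceil (xstar i)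
  obtain ⟨w, hwN, hw⟩ := N.exists_min_image (fun z => f fun i => (z i : ℝ)) ⟨_, hroundN⟩
  refine ⟨w, (hN w).mp hwN, fun z => ?_⟩
  by_cases hz : z ∈ N
  · exact hw z hz
  · exact (hw _ hroundN).trans (hround z (mt (hN z).mpr hz))
end

section
/- Let n ≥ 2, let M be an n×n real symmetric positive definite matrix with smallest eigenvalue λ_min and largest eigenvalue λ_max, and set κ = λ_max/λ_min; assume κ > 1 and (n−1)(κ² − 1)² ≤ κ². Let b ∈ ℝⁿ, f(x) = ½ xᵀ M x + bᵀ x, and x* = −M⁻¹ b. Fix an index i, let k = ⌊x*_i⌋ and δ = x*_i − k, and suppose δ ≤ (√(κ² − (n−1)(κ² − 1)²) − 1)/(κ² − 1). Then for every z ∈ ℤⁿ with z_i = k + 1 and |z_j − x*_j| ≤ 1 for all j ≠ i, the vector z′ defined by z′_i = k and z′_j = z_j for j ≠ i satisfies f(z′) ≤ f(z). -/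
open Matrix

open scoped MatrixOrder in
/-- A lower bound on the eigenvalues of a real symmetric matrix bounds its quadratic form below. -/
theorem mul_dotProduct_le_of_le_eigenvalues {ι : Type*} [Fintype ι] [DecidableEq ι]
    {M : Matrix ι ι ℝ} (hM : M.IsHermitian) {c : ℝ} (hc : ∀ i, c ≤ hM.eigenvalues i)
    (y : ι → ℝ) : c * (y ⬝ᵥ y) ≤ y ⬝ᵥ (M *ᵥ y) := by
  have h : algebraMap ℝ (Matrix ι ι ℝ) c ≤ M := by
    rw [algebraMap_le_iff_le_spectrum (ha := hM.isSelfAdjoint),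
      hM.spectrum_real_eq_range_eigenvalues]
    rintro _ ⟨j, rfl⟩
    exact hc j
  have h2 := (Matrix.le_iff.mp h).dotProduct_mulVec_nonneg y
  rw [Algebra.algebraMap_eq_smul_one, sub_mulVec, smul_mulVec, one_mulVec, dotProduct_sub,
    dotProduct_smul, smul_eq_mul, star_trivial] at h2
  linarith

open scoped MatrixOrder in
/-- An upper bound on the eigenvalues of a real symmetric matrix bounds its quadratic form above. -/
theorem dotProduct_le_mul_of_eigenvalues_le {ι : Type*} [Fintype ι] [DecidableEq ι]
    {M : Matrix ι ι ℝ} (hM : M.IsHermitian) {c : ℝ} (hc : ∀ i, hM.eigenvalues i ≤ c)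
    (y : ι → ℝ) : y ⬝ᵥ (M *ᵥ y) ≤ c * (y ⬝ᵥ y) := by
  have h : M ≤ algebraMap ℝ (Matrix ι ι ℝ) c := by
    rw [le_algebraMap_iff_spectrum_le (ha := hM.isSelfAdjoint),
      hM.spectrum_real_eq_range_eigenvalues]
    rintro _ ⟨j, rfl⟩
    exact hc j
  have h2 := (Matrix.le_iff.mp h).dotProduct_mulVec_nonneg y
  rw [Algebra.algebraMap_eq_smul_one, sub_mulVec, smul_mulVec, one_mulVec, dotProduct_sub,
    dotProduct_smul, smul_eq_mul, star_trivial] at h2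
  linarith

/-- Completing the square in a quadratic objective around its stationary point. -/
theorem quadratic_eq_add_of_mulVec_eq_neg {ι : Type*} [Fintype ι]
    {M : Matrix ι ι ℝ} (hM : M.IsSymm) {b x₀ : ι → ℝ} (hx₀ : M *ᵥ x₀ = -b) (x : ι → ℝ) :
    (1 / 2) * (x ⬝ᵥ (M *ᵥ x)) + b ⬝ᵥ x =
      (1 / 2) * ((x - x₀) ⬝ᵥ (M *ᵥ (x - x₀))) - (1 / 2) * (x₀ ⬝ᵥ (M *ᵥ x₀)) := by
  have h : x₀ ⬝ᵥ (M *ᵥ x) = x ⬝ᵥ (M *ᵥ x₀) := by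
    rw [dotProduct_mulVec, ← mulVec_transpose, hM.eq, dotProduct_comm]
  rw [mulVec_sub, sub_dotProduct, dotProduct_sub, dotProduct_sub, h, hx₀, dotProduct_neg,
    dotProduct_comm b x]
  ring

/-- A nonnegative number below the larger root of the threshold quadratic makes
that quadratic nonpositive. -/
theorem threshold_quadratic_le {κ δ m : ℝ} (hκ : 1 < κ) (hm : m * (κ ^ 2 - 1) ^ 2 ≤ κ ^ 2)
    (hδ : 0 ≤ δ) (hδle : δ ≤ (√(κ ^ 2 - m * (κ ^ 2 - 1) ^ 2) - 1) / (κ ^ 2 - 1)) :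
    κ ^ 2 * (δ ^ 2 + m) ≤ (1 - δ) ^ 2 + m := by
  have ha : 0 < κ ^ 2 - 1 := by nlinarith
  rw [le_div_iff₀ ha] at hδle
  have hsq := Real.sq_sqrt (sub_nonneg.mpr hm)
  have h : (δ * (κ ^ 2 - 1) + 1) ^ 2 ≤ κ ^ 2 - m * (κ ^ 2 - 1) ^ 2 := by
    rw [← hsq]
    exact pow_le_pow_left₀ (by positivity) (by linarith) 2
  have h2 : (κ ^ 2 - 1) * (κ ^ 2 * (δ ^ 2 + m)) ≤ (κ ^ 2 - 1) * ((1 - δ) ^ 2 + m) := by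
    linarith
  exact le_of_mul_le_mul_left h2 ha



/-- If the fractional part `δ` of the `i`-th coordinate of the continuous minimiser
`x* = −M⁻¹b` satisfies `δ ≤ (√(κ² − (n−1)(κ²−1)²) − 1)/(κ² − 1)`, where `κ` is the
condition number of the symmetric positive definite matrix `M`, then rounding the
`i`-th coordinate down to `k = ⌊x*_i⌋` never increases `f(x) = ½ xᵀ M x + bᵀ x`
compared to rounding it up to `k+1`, for any integer point whose other coordinates
lie within distance `1` of those of `x*`. -/
theorem stmt_9 (n : ℕ) (hn : 2 ≤ n)
    (M : Matrix (Fin n) (Fin n) ℝ) (hM : M.PosDef)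
    (lmin lmax : ℝ)
    (hmin_mem : ∃ i, hM.1.eigenvalues i = lmin)
    (hmin_le : ∀ i, lmin ≤ hM.1.eigenvalues i)
    (hmax_mem : ∃ i, hM.1.eigenvalues i = lmax)
    (hmax_ge : ∀ i, hM.1.eigenvalues i ≤ lmax)
    (κ : ℝ) (hκdef : κ = lmax / lmin) (hκ : 1 < κ)
    (hκn : ((n : ℝ) - 1) * (κ ^ 2 - 1) ^ 2 ≤ κ ^ 2)
    (b : Fin n → ℝ)
    (f : (Fin n → ℝ) → ℝ)
    (hf : ∀ x, f x = (1 / 2) * (x ⬝ᵥ (M *ᵥ x)) + b ⬝ᵥ x)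
    (xstar : Fin n → ℝ) (hxstar : xstar = -(M⁻¹ *ᵥ b))
    (i : Fin n) (k : ℤ) (hk : k = ⌊xstar i⌋)
    (δ : ℝ) (hδ : δ = xstar i - (k : ℝ))
    (hδle : δ ≤ (Real.sqrt (κ ^ 2 - ((n : ℝ) - 1) * (κ ^ 2 - 1) ^ 2) - 1) / (κ ^ 2 - 1)) :
    ∀ z : Fin n → ℤ, z i = k + 1 → (∀ j, j ≠ i → |(z j : ℝ) - xstar j| ≤ 1) →
      f (fun j => ((Function.update z i k) j : ℝ)) ≤ f (fun j => (z j : ℝ)) := by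
  intro z hz hzj
  have hlmin : 0 < lmin := by
    obtain ⟨j, rfl⟩ := hmin_mem
    exact hM.eigenvalues_pos j
  have hlmax : lmax = lmin * κ := by
    rw [hκdef]
    field_simp
  have hstat : M *ᵥ xstar = -b := by
    rw [hxstar, mulVec_neg, mulVec_mulVec,
      mul_nonsing_inv _ ((isUnit_iff_isUnit_det M).mp hM.isUnit), one_mulVec]
  have hsymm : M.IsSymm := by
    simpa [IsHermitian, IsSymm, conjTranspose_eq_transpose_of_trivial] using hM.1
  rw [hf, hf, quadratic_eq_add_of_mulVec_eq_neg hsymm hstat,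
    quadratic_eq_add_of_mulVec_eq_neg hsymm hstat]
  set y' : Fin n → ℝ := (fun j => ((Function.update z i k) j : ℝ)) - xstar with hy'
  set y : Fin n → ℝ := (fun j => (z j : ℝ)) - xstar with hy
  set s : ℝ := ∑ j ∈ Finset.univ.erase i, ((z j : ℝ) - xstar j) ^ 2 with hs
  have hyy : y ⬝ᵥ y = (1 - δ) ^ 2 + s := by
    rw [dotProduct, ← Finset.add_sum_erase _ _ (Finset.mem_univ i), hs]
    congr 1
    · simp only [hy, Pi.sub_apply, hz, hδ]
      push_cast
      ring
    · exact Finset.sum_congr rfl fun j _ => by simp only [hy, Pi.sub_apply]; ring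
  have hyy' : y' ⬝ᵥ y' = δ ^ 2 + s := by
    rw [dotProduct, ← Finset.add_sum_erase _ _ (Finset.mem_univ i), hs]
    congr 1
    · simp only [hy', Pi.sub_apply, Function.update_self, hδ]
      ring
    · refine Finset.sum_congr rfl fun j hj => ?_
      simp only [hy', Pi.sub_apply, Function.update_of_ne (Finset.ne_of_mem_erase hj)]
      ring
  have hs0 : 0 ≤ s := Finset.sum_nonneg fun j _ => sq_nonneg _
  have hsn : s ≤ (n : ℝ) - 1 := by
    have h : s ≤ ∑ j ∈ Finset.univ.erase i, (1 : ℝ) := Finset.sum_le_sum fun j hj =>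
      (sq_le_one_iff_abs_le_one _).mpr (hzj j (Finset.ne_of_mem_erase hj))
    simpa [Finset.card_erase_of_mem, Nat.cast_sub (show 1 ≤ n by omega)] using h
  have hδ0 : 0 ≤ δ := by
    rw [hδ, hk]
    exact sub_nonneg.mpr (Int.floor_le _)
  have hquad := threshold_quadratic_le hκ hκn hδ0 hδle
  have hkey : κ * (δ ^ 2 + s) ≤ (1 - δ) ^ 2 + s := by
    have h1 : κ * (δ ^ 2 + s) ≤ κ ^ 2 * (δ ^ 2 + s) :=
      mul_le_mul_of_nonneg_right (by nlinarith) (by positivity)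
    have h2 : (κ ^ 2 - 1) * s ≤ (κ ^ 2 - 1) * ((n : ℝ) - 1) :=
      mul_le_mul_of_nonneg_left hsn (by nlinarith)
    linarith
  have hupper := dotProduct_le_mul_of_eigenvalues_le hM.1 hmax_ge y'
  have hlower := mul_dotProduct_le_of_le_eigenvalues hM.1 hmin_le y
  rw [hyy', hlmax, mul_assoc] at hupper
  rw [hyy] at hlower
  linarith [mul_le_mul_of_nonneg_left hkey hlmin.le]
end

section
/- Let n ≥ 1 be an integer and let κ, c, δ be real numbers with κ > 1, 0 ≤ c ≤ n − 1, (n−1)(κ² − 1)² ≤ κ², and 0 ≤ δ ≤ (√(κ² − (n−1)(κ² − 1)²) − 1)/(κ² − 1). Then κ²·(c + δ²) ≤ c + (1 − δ)². -/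
/-- The arithmetic inequality underlying the coordinate-rounding threshold bound:
for `n ≥ 1`, `κ > 1`, `0 ≤ c ≤ n − 1`, `(n−1)(κ²−1)² ≤ κ²`, and
`0 ≤ δ ≤ (√(κ² − (n−1)(κ²−1)²) − 1)/(κ² − 1)`, one has
`κ²(c + δ²) ≤ c + (1 − δ)²`. -/
theorem stmt_10 (n : ℕ) (hn : 1 ≤ n) (κ c δ : ℝ)
    (hκ : 1 < κ) (hc0 : 0 ≤ c) (hc : c ≤ (n : ℝ) - 1)
    (hκn : ((n : ℝ) - 1) * (κ ^ 2 - 1) ^ 2 ≤ κ ^ 2)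
    (hδ0 : 0 ≤ δ)
    (hδ : δ ≤ (Real.sqrt (κ ^ 2 - ((n : ℝ) - 1) * (κ ^ 2 - 1) ^ 2) - 1) / (κ ^ 2 - 1)) :
    κ ^ 2 * (c + δ ^ 2) ≤ c + (1 - δ) ^ 2 := by
  have hm : 0 < κ ^ 2 - 1 := by nlinarith
  rw [le_div_iff₀ hm, le_sub_iff_add_le] at hδ
  have hsq : (δ * (κ ^ 2 - 1) + 1) ^ 2 ≤ κ ^ 2 - ((n : ℝ) - 1) * (κ ^ 2 - 1) ^ 2 :=
    (Real.le_sqrt (by positivity) (sub_nonneg.2 hκn)).1 hδ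
  have hquad : (κ ^ 2 - 1) * δ ^ 2 + 2 * δ + ((n : ℝ) - 1) * (κ ^ 2 - 1) ≤ 1 := by
    refine le_of_mul_le_mul_left ?_ hm
    linarith
  have hcm := mul_le_mul_of_nonneg_right hc hm.le
  linarith
end
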